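/- Let n ≥ 2, D ⊂ ℝⁿ a bounded Lipschitz domain, B(D) the smallest ball containing D, of radius d, and let H be the capacity potential of D (for n ≥ 3: the solution of ΔH = 0 in ℝⁿ∖cl(D), H = 1 on ∂D, H(x) → 0 as |x| → ∞; for n = 2: the solution of ΔH = 0 in B₁∖cl(D), H = 1 on ∂D, H = 0 on ∂B₁, where B₁ is the unit ball concentric with B(D)). Denote ρ(x) = dist(x, B(D)). Then there exist constants C, C₀ > 0 (depending only on n) such that for all x ∈ ℝⁿ∖cl(B(D)): if n ≥ 3 and ρ(x) ≥ C₀d, then |H(x)| ≤ C·d^{n−2}/ρ(x)^{n−2} and |∇H(x)| ≤ C·d^{n−2}/ρ(x)^{n−1}; if n = 2 and ρ(x) ≥ exp(−C₀√|ln d|), then |H(x)| ≤ C·|ln d|^{−1}·|ln ρ(x)| and |∇H(x)| ≤ C·|ln d|^{−1}/ρ(x). -/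

import Mathlib

open MeasureTheory Metric Filter Set
open scoped Topology ENNReal

noncomputable section

abbrev Euc (n : ℕ) := EuclideanSpace ℝ (Fin n)

/-- `j`-th standard basis vector of `ℝⁿ`. -/
def ebasis {n : ℕ} (j : Fin n) : Euc n := EuclideanSpace.single j 1

/-- The Laplacian `ΔH = Σ_j ∂²_{jj} H`. -/
def lap {n : ℕ} (H : Euc n → ℝ) (x : Euc n) : ℝ :=
  ∑ j, fderiv ℝ (fun y => fderiv ℝ H y (ebasis j)) x (ebasis j)

/-- `H` is the capacity potential of `D` for `n ≥ 3`: `ΔH = 0` outside `cl D`, `H = 1`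
on `cl D` (extended by `1` inside), `H → 0` at infinity, continuous on `ℝⁿ`. -/
def IsCapPotential {n : ℕ} (D : Set (Euc n)) (H : Euc n → ℝ) : Prop :=
  Continuous H ∧ (∀ x ∈ closure D, H x = 1) ∧
  ContDiffOn ℝ 2 H (closure D)ᶜ ∧ (∀ x ∉ closure D, lap H x = 0) ∧
  Tendsto H (Filter.cocompact (Euc n)) (𝓝 0)

/-- `H` is the relative capacity potential of `D` w.r.t. the unit ball `B₁ = B(x₀,1)`
(the `n = 2` case): `ΔH = 0` in `B₁ ∖ cl D`, `H = 1` on `cl D`, `H = 0` outside `B₁`. -/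
def IsCapPotentialRel {n : ℕ} (x₀ : Euc n) (D : Set (Euc n)) (H : Euc n → ℝ) : Prop :=
  Continuous H ∧ (∀ x ∈ closure D, H x = 1) ∧
  ContDiffOn ℝ 2 H (ball x₀ 1 \ closure D) ∧
  (∀ x ∈ ball x₀ 1 \ closure D, lap H x = 0) ∧
  ∀ x ∉ ball x₀ 1, H x = 0

/-- `D` is a (bounded) Lipschitz domain: locally the sublevel set of a Lipschitz function. -/
def LipschitzDomain {n : ℕ} (D : Set (Euc n)) : Prop :=
  IsOpen D ∧ D.Nonempty ∧ Bornology.IsBounded D ∧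
  ∃ r L : ℝ, 0 < r ∧ 0 < L ∧ ∀ x ∈ frontier D, ∃ φ : Euc n → ℝ,
    LipschitzWith (Real.toNNReal L) φ ∧
    D ∩ ball x r = {y ∈ ball x r | φ y < 0} ∧
    frontier D ∩ ball x r = {y ∈ ball x r | φ y = 0}

section HarmonicTools

open InnerProductSpace Laplacian

variable {E : Type*} [NormedAddCommGroup E] [InnerProductSpace ℝ E]

theorem hasDerivAt_add_smul (x e : E) (t : ℝ) : HasDerivAt (fun t : ℝ => x + t • e) e t := by
  simpa using ((hasDerivAt_id t).smul_const e).const_add x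

theorem eventually_hasDerivAt_line {f : E → ℝ} {x : E} (hf : ContDiffAt ℝ 2 f x) (e : E) :
    ∀ᶠ t in 𝓝 (0 : ℝ), HasDerivAt (fun t : ℝ => f (x + t • e)) (fderiv ℝ f (x + t • e) e) t := by
  have hc : Tendsto (fun t : ℝ => x + t • e) (𝓝 0) (𝓝 x) := by
    simpa using (hasDerivAt_add_smul x e 0).continuousAt.tendsto
  filter_upwards [hc.eventually (hf.eventually (by simp))] with t ht
  exact (ht.differentiableAt (by simp)).hasFDerivAt.comp_hasDerivAt t (hasDerivAt_add_smul x e t)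

theorem hasDerivAt_fderiv_line {f : E → ℝ} {x : E} (hf : ContDiffAt ℝ 2 f x) (e : E) :
    HasDerivAt (fun t : ℝ => fderiv ℝ f (x + t • e) e) (fderiv ℝ (fderiv ℝ f) x e e) 0 := by
  have h : DifferentiableAt ℝ (fderiv ℝ f) (x + (0 : ℝ) • e) := by
    simpa using (hf.fderiv_right (m := 1) (by norm_num)).differentiableAt (by simp)
  have k : HasDerivAt (fun t : ℝ => fderiv ℝ f (x + t • e))
      (fderiv ℝ (fderiv ℝ f) (x + (0 : ℝ) • e) e) 0 :=
    h.hasFDerivAt.comp_hasDerivAt (0 : ℝ) (hasDerivAt_add_smul x e 0)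
  rw [zero_smul, add_zero] at k
  exact (ContinuousLinearMap.apply ℝ ℝ e).hasFDerivAt.comp_hasDerivAt (0 : ℝ) k

theorem IsLocalMax.fderiv_fderiv_nonpos {f : E → ℝ} {x : E} (h : IsLocalMax f x)
    (hf : ContDiffAt ℝ 2 f x) (e : E) : fderiv ℝ (fderiv ℝ f) x e e ≤ 0 := by
  by_contra! hpos
  set g : ℝ → ℝ := fun t => f (x + t • e) with hg
  have hd := eventually_hasDerivAt_line hf e
  have hdg : deriv g =ᶠ[𝓝 0] fun t => fderiv ℝ f (x + t • e) e := hd.mono fun t ht => ht.deriv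
  have hc : ContinuousAt (fun t : ℝ => x + t • e) 0 := (hasDerivAt_add_smul x e 0).continuousAt
  have hmax : IsLocalMax g 0 := by
    have hc' : Tendsto (fun t : ℝ => x + t • e) (𝓝 0) (𝓝 x) := by simpa using hc.tendsto
    have := hc'.eventually h
    simpa [IsLocalMax, IsMaxFilter, hg] using this
  have hdd : deriv (deriv g) 0 = fderiv ℝ (fderiv ℝ f) x e e := by
    rw [hdg.deriv_eq, (hasDerivAt_fderiv_line hf e).deriv]
  have hmin : IsLocalMin g 0 := isLocalMin_of_deriv_deriv_pos (by rw [hdd]; exact hpos)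
    hmax.deriv_eq_zero hd.self_of_nhds.continuousAt
  have hconst : g =ᶠ[𝓝 0] fun _ => g 0 := by
    filter_upwards [hmax, hmin] with t h1 h2 using le_antisymm h1 h2
  have h2 : deriv g =ᶠ[𝓝 0] fun _ => 0 := by
    simpa using hconst.deriv
  rw [h2.deriv_eq] at hdd
  simp at hdd
  linarith

theorem reflection_orthogonal_span_eq_self {e y : E} (h : inner ℝ e y = 0) :
    (ℝ ∙ e)ᗮ.reflection y = y :=
  Submodule.reflection_mem_subspace_eq_self (Submodule.mem_orthogonal_singleton_iff_inner_right.2 h)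

theorem norm_sub_reflection (w z : E) :
    ‖z - (ℝ ∙ w)ᗮ.reflection z‖ = 2 * (|inner ℝ w z| / ‖w‖) := by
  rcases eq_or_ne w 0 with rfl | hw
  · have : (ℝ ∙ (0 : E))ᗮ.reflection z = z := reflection_orthogonal_span_eq_self (by simp)
    rw [this]; simp
  have hw' : 0 < ‖w‖ := norm_pos_iff.2 hw
  rw [Submodule.reflection_orthogonal_apply, Submodule.reflection_singleton_apply]
  simp only [neg_sub, RCLike.ofReal_real_eq_id, id]
  rw [sub_sub_cancel, ← Nat.cast_smul_eq_nsmul ℝ, smul_smul, norm_smul]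
  simp
  field_simp

variable [FiniteDimensional ℝ E]

theorem laplacian_eq_sum_fderiv_fderiv {ι : Type*} [Fintype ι] (b : OrthonormalBasis ι ℝ E)
    (f : E → ℝ) (x : E) : Δ f x = ∑ i, fderiv ℝ (fderiv ℝ f) x (b i) (b i) := by
  simp [laplacian_eq_iteratedFDeriv_orthonormalBasis f b, iteratedFDeriv_two_apply]

theorem laplacian_eq_sum_of_hasDerivAt {ι : Type*} [Fintype ι] (b : OrthonormalBasis ι ℝ E)
    {f : E → ℝ} {x : E} (hf : ContDiffAt ℝ 2 f x) {g : ι → ℝ → ℝ} {a : ι → ℝ}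
    (hg : ∀ i, ∀ᶠ t in 𝓝 (0 : ℝ), HasDerivAt (fun t : ℝ => f (x + t • b i)) (g i t) t)
    (ha : ∀ i, HasDerivAt (g i) (a i) 0) : Δ f x = ∑ i, a i := by
  rw [laplacian_eq_sum_fderiv_fderiv b]
  refine Finset.sum_congr rfl fun i _ => ?_
  have h : g i =ᶠ[𝓝 0] fun t => fderiv ℝ f (x + t • b i) (b i) := by
    filter_upwards [hg i, eventually_hasDerivAt_line hf (b i)] with t h1 h2 using h1.unique h2
  exact ((hasDerivAt_fderiv_line hf (b i)).congr_of_eventuallyEq h).unique (ha i)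

theorem laplacian_comp_add_linearIsometryEquiv (f : E → ℝ) (c : E) (R : E ≃ₗᵢ[ℝ] E) (x : E)
    (hf : ContDiffAt ℝ 2 f (c + R x)) :
    Δ (fun y => f (c + R y)) x = Δ f (c + R x) := by
  set b := stdOrthonormalBasis ℝ E
  rw [laplacian_eq_sum_fderiv_fderiv (b.map R) f]
  have hcd : ContDiffAt ℝ 2 (fun y => f (c + R y)) x :=
    hf.comp x (contDiffAt_const.add R.contDiff.contDiffAt)
  refine laplacian_eq_sum_of_hasDerivAt b hcd (fun i => ?_)
    (fun i => hasDerivAt_fderiv_line hf (b.map R i))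
  filter_upwards [eventually_hasDerivAt_line hf (b.map R i)] with t ht
  simpa [map_add, add_assoc] using ht

theorem InnerProductSpace.HarmonicAt.comp_add_linearIsometryEquiv {f : E → ℝ} {c : E}
    {R : E ≃ₗᵢ[ℝ] E} {x : E} (hf : HarmonicAt f (c + R x)) :
    HarmonicAt (fun y => f (c + R y)) x := by
  have hA : ContDiff ℝ 2 fun y => c + R y := contDiff_const.add R.contDiff
  refine ⟨hf.1.comp x hA.contDiffAt, ?_⟩
  filter_upwards [hA.continuous.continuousAt.eventually hf.eventually] with y hy
  rw [laplacian_comp_add_linearIsometryEquiv f c R y hy.1]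
  exact hy.2.self_of_nhds

theorem laplacian_affine_mul_radial {φ φ' : ℝ → ℝ} {φ'' α : ℝ} {e x : E}
    (hφ : ContDiffAt ℝ 2 φ (‖x‖ ^ 2))
    (h1 : ∀ᶠ s in 𝓝 (‖x‖ ^ 2), HasDerivAt φ (φ' s) s) (h2 : HasDerivAt φ' φ'' (‖x‖ ^ 2)) :
    Δ (fun y : E => (α + inner ℝ e y) * φ (‖y‖ ^ 2)) x =
      4 * φ' (‖x‖ ^ 2) * inner ℝ e x + (α + inner ℝ e x) *
        (4 * ‖x‖ ^ 2 * φ'' + 2 * Module.finrank ℝ E * φ' (‖x‖ ^ 2)) := by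
  set b := stdOrthonormalBasis ℝ E
  have hcd : ContDiffAt ℝ 2 (fun y : E => (α + inner ℝ e y) * φ (‖y‖ ^ 2)) x :=
    (contDiffAt_const.add (contDiffAt_const.inner ℝ contDiffAt_id)).mul
      (hφ.comp x (contDiff_norm_sq ℝ).contDiffAt)
  have hq : ∀ i (t : ℝ), ‖x + t • b i‖ ^ 2 = ‖x‖ ^ 2 + 2 * t * inner ℝ x (b i) + t ^ 2 := by
    intro i t
    rw [norm_add_sq_real, norm_smul, inner_smul_right, b.norm_eq_one i]
    simp; ring
  have hl : ∀ i (t : ℝ), α + inner ℝ e (x + t • b i) = α + inner ℝ e x + t * inner ℝ e (b i) := by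
    intro i t
    rw [inner_add_right, inner_smul_right]; ring
  have hdq : ∀ i (t : ℝ), HasDerivAt
      (fun t : ℝ => ‖x‖ ^ 2 + 2 * t * inner ℝ x (b i) + t ^ 2) (2 * inner ℝ x (b i) + 2 * t) t := by
    intro i t
    have := ((((hasDerivAt_id t).const_mul 2).mul_const (inner ℝ x (b i))).const_add
      (‖x‖ ^ 2)).add ((hasDerivAt_id t).pow 2)
    refine (this.congr_deriv ?_).congr_of_eventuallyEq (Eventually.of_forall fun s => ?_) <;> simp
  have hdl : ∀ i (t : ℝ), HasDerivAt
      (fun t : ℝ => α + inner ℝ e x + t * inner ℝ e (b i)) (inner ℝ e (b i)) t := by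
    intro i t
    simpa using ((hasDerivAt_id t).mul_const (inner ℝ e (b i))).const_add (α + inner ℝ e x)
  have hg : ∀ i, ∀ᶠ t in 𝓝 (0 : ℝ), HasDerivAt
      (fun t : ℝ => (α + inner ℝ e (x + t • b i)) * φ (‖x + t • b i‖ ^ 2))
      (inner ℝ e (b i) * φ (‖x‖ ^ 2 + 2 * t * inner ℝ x (b i) + t ^ 2) +
        (α + inner ℝ e x + t * inner ℝ e (b i)) *
          (φ' (‖x‖ ^ 2 + 2 * t * inner ℝ x (b i) + t ^ 2) * (2 * inner ℝ x (b i) + 2 * t))) t := by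
    intro i
    have hc : Tendsto (fun t : ℝ => ‖x‖ ^ 2 + 2 * t * inner ℝ x (b i) + t ^ 2) (𝓝 0)
        (𝓝 (‖x‖ ^ 2)) := by
      simpa using (hdq i 0).continuousAt.tendsto
    filter_upwards [hc.eventually h1] with t ht
    simp only [hq, hl]
    exact (hdl i t).mul (ht.comp t (hdq i t))
  have ha : ∀ i, HasDerivAt (fun t : ℝ =>
      inner ℝ e (b i) * φ (‖x‖ ^ 2 + 2 * t * inner ℝ x (b i) + t ^ 2) +
        (α + inner ℝ e x + t * inner ℝ e (b i)) *
          (φ' (‖x‖ ^ 2 + 2 * t * inner ℝ x (b i) + t ^ 2) * (2 * inner ℝ x (b i) + 2 * t)))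
      (4 * φ' (‖x‖ ^ 2) * (inner ℝ e (b i) * inner ℝ (b i) x) + (α + inner ℝ e x) *
        (4 * φ'' * (inner ℝ x (b i) * inner ℝ (b i) x) + 2 * φ' (‖x‖ ^ 2))) 0 := by
    intro i
    have hφ0 := h1.self_of_nhds
    have e0 : ‖x‖ ^ 2 = ‖x‖ ^ 2 + 2 * (0 : ℝ) * inner ℝ x (b i) + (0 : ℝ) ^ 2 := by ring
    have k1 := HasDerivAt.comp (0 : ℝ) (by rw [← e0]; exact hφ0) (hdq i 0)
    have k2 := HasDerivAt.comp (0 : ℝ) (by rw [← e0]; exact h2) (hdq i 0)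
    have k3 : HasDerivAt (fun t : ℝ => 2 * inner ℝ x (b i) + 2 * t) 2 0 := by
      simpa using ((hasDerivAt_id (0 : ℝ)).const_mul 2).const_add (2 * inner ℝ x (b i))
    have := (k1.const_mul (inner ℝ e (b i))).add ((hdl i 0).mul (k2.mul k3))
    refine this.congr_deriv ?_
    change _ + (_ * (φ' (‖x‖ ^ 2 + 2 * (0 : ℝ) * inner ℝ x (b i) + (0 : ℝ) ^ 2) *
      (2 * inner ℝ x (b i) + 2 * (0 : ℝ))) + _) = _
    simp only [Function.comp, ← e0]
    rw [real_inner_comm x (b i)]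
    ring
  rw [laplacian_eq_sum_of_hasDerivAt b hcd hg ha, Finset.sum_add_distrib, ← Finset.mul_sum,
    ← Finset.mul_sum, Finset.sum_add_distrib, ← Finset.mul_sum, b.sum_inner_mul_inner,
    b.sum_inner_mul_inner, real_inner_self_eq_norm_sq]
  simp only [Finset.sum_const, Finset.card_univ, Fintype.card_fin, nsmul_eq_mul]
  ring

theorem laplacian_inner_sq (e x : E) : Δ (fun y : E => inner ℝ e y ^ 2) x = 2 * ‖e‖ ^ 2 := by
  set b := stdOrthonormalBasis ℝ E
  have hcd : ContDiffAt ℝ 2 (fun y : E => inner ℝ e y ^ 2) x :=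
    (contDiffAt_const.inner ℝ contDiffAt_id).pow 2
  have hd : ∀ i (t : ℝ), HasDerivAt (fun t : ℝ => inner ℝ e x + t * inner ℝ e (b i))
      (inner ℝ e (b i)) t := by
    intro i t
    simpa using ((hasDerivAt_id t).mul_const (inner ℝ e (b i))).const_add (inner ℝ e x)
  rw [laplacian_eq_sum_of_hasDerivAt b hcd
    (g := fun i t => 2 * (inner ℝ e x + t * inner ℝ e (b i)) * inner ℝ e (b i))
    (a := fun i => 2 * (inner ℝ e (b i) * inner ℝ (b i) e)), ← Finset.mul_sum,
    b.sum_inner_mul_inner, real_inner_self_eq_norm_sq]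
  · intro i
    filter_upwards with t
    simp only [inner_add_right, inner_smul_right]
    exact ((hd i t).pow 2).congr_deriv (by simp)
  · intro i
    refine (((hd i 0).const_mul 2).mul_const (inner ℝ e (b i))).congr_deriv ?_
    rw [real_inner_comm e (b i)]; ring

theorem laplacian_norm_sq (x : E) :
    Δ (fun y : E => ‖y‖ ^ 2) x = 2 * Module.finrank ℝ E := by
  have := laplacian_affine_mul_radial (φ := id) (φ' := fun _ => 1) (φ'' := 0) (α := 1)
    (e := (0 : E)) (x := x) contDiffAt_id (Eventually.of_forall fun s => hasDerivAt_id s)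
    (hasDerivAt_const _ _)
  simpa using this

theorem laplacian_inner (e x : E) : Δ (fun y : E => (inner ℝ e y : ℝ)) x = 0 := by
  have := laplacian_affine_mul_radial (φ := fun _ => 1) (φ' := fun _ => 0) (φ'' := 0) (α := 0)
    (e := e) (x := x) contDiffAt_const (Eventually.of_forall fun s => hasDerivAt_const _ _)
    (hasDerivAt_const _ _)
  simpa using this

theorem harmonicAt_norm_sq_rpow {x : E} (hx : x ≠ 0) :
    HarmonicAt (fun y : E => (‖y‖ ^ 2) ^ (1 - (Module.finrank ℝ E : ℝ) / 2)) x := by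
  set q : ℝ := 1 - (Module.finrank ℝ E : ℝ) / 2 with hq
  have hpos : ∀ y : E, y ≠ 0 → 0 < ‖y‖ ^ 2 := fun y hy => by positivity
  refine ⟨((contDiff_norm_sq ℝ).contDiffAt).rpow_const_of_ne (hpos x hx).ne', ?_⟩
  filter_upwards [isOpen_ne.mem_nhds hx] with y hy
  have hs := hpos y hy
  have h := laplacian_affine_mul_radial (φ := fun s => s ^ q) (φ' := fun s => q * s ^ (q - 1))
    (φ'' := q * ((q - 1) * (‖y‖ ^ 2) ^ (q - 1 - 1))) (α := 1) (e := (0 : E)) (x := y)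
    (Real.contDiffAt_rpow_const_of_ne hs.ne')
    ((eventually_ne_nhds hs.ne').mono fun s hs => Real.hasDerivAt_rpow_const (Or.inl hs))
    ((Real.hasDerivAt_rpow_const (Or.inl hs.ne')).const_mul q)
  simp only [inner_zero_left, add_zero, one_mul, mul_zero, zero_add] at h
  rw [h]
  have e1 : ‖y‖ ^ 2 * (‖y‖ ^ 2) ^ (q - 1 - 1) = (‖y‖ ^ 2) ^ (q - 1) := by
    rw [Real.rpow_sub_one hs.ne' (q - 1)]; field_simp
  have e2 : (Module.finrank ℝ E : ℝ) = 2 - 2 * q := by rw [hq]; ring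
  rw [e2, Pi.zero_apply]
  linear_combination (4 * q * (q - 1)) * e1

theorem harmonicAt_log_norm_sq (hE : Module.finrank ℝ E = 2) {x : E} (hx : x ≠ 0) :
    HarmonicAt (fun y : E => Real.log (‖y‖ ^ 2)) x := by
  have hpos : ∀ y : E, y ≠ 0 → 0 < ‖y‖ ^ 2 := fun y hy => by positivity
  refine ⟨((contDiff_norm_sq ℝ).contDiffAt).log (hpos x hx).ne', ?_⟩
  filter_upwards [isOpen_ne.mem_nhds hx] with y hy
  have hs := hpos y hy
  have h := laplacian_affine_mul_radial (φ := Real.log) (φ' := fun s => s⁻¹)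
    (φ'' := -((‖y‖ ^ 2) ^ 2)⁻¹) (α := 1) (e := (0 : E)) (x := y)
    (Real.contDiffAt_log.2 hs.ne')
    ((eventually_ne_nhds hs.ne').mono fun s hs => Real.hasDerivAt_log hs)
    (hasDerivAt_inv hs.ne')
  simp only [inner_zero_left, add_zero, one_mul, mul_zero, zero_add] at h
  rw [h, hE]
  field_simp
  norm_num

theorem harmonicAt_inner_div_norm_sq (hE : Module.finrank ℝ E = 2) (e : E) {x : E}
    (hx : x ≠ 0) : HarmonicAt (fun y : E => inner ℝ e y * (‖y‖ ^ 2)⁻¹) x := by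
  have hpos : ∀ y : E, y ≠ 0 → 0 < ‖y‖ ^ 2 := fun y hy => by positivity
  refine ⟨(contDiffAt_const.inner ℝ contDiffAt_id).mul
    (((contDiff_norm_sq ℝ).contDiffAt).inv (hpos x hx).ne'), ?_⟩
  filter_upwards [isOpen_ne.mem_nhds hx] with y hy
  have hs := hpos y hy
  have h := laplacian_affine_mul_radial (φ := fun s : ℝ => s⁻¹) (φ' := fun s => -(s ^ 2)⁻¹)
    (φ'' := 2 * ((‖y‖ ^ 2) ^ 3)⁻¹) (α := 0) (e := e) (x := y)
    (contDiffAt_inv ℝ hs.ne')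
    ((eventually_ne_nhds hs.ne').mono fun s hs => hasDerivAt_inv hs)
    ((((hasDerivAt_pow 2 (‖y‖ ^ 2)).inv (pow_ne_zero 2 hs.ne')).neg).congr_deriv
      (by field_simp; norm_num; ring))
  simp only [zero_add] at h
  rw [h, hE]
  field_simp
  norm_num

theorem harmonic_nonpos_of_boundary_nonpos [Nontrivial E] {K U : Set E} (hK : IsCompact K)
    (hU : IsOpen U) (hUK : U ⊆ K) {u : E → ℝ} (hu : ContinuousOn u K)
    (hΔ : ∀ x ∈ U, HarmonicAt u x) (hb : ∀ x ∈ K, x ∉ U → u x ≤ 0) : ∀ x ∈ K, u x ≤ 0 := by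
  intro x₀ hx₀
  by_contra! hm
  obtain ⟨R, hR⟩ := hK.isBounded.exists_norm_le
  set ε : ℝ := u x₀ / (R ^ 2 + 1) with hε
  have hε0 : 0 < ε := by positivity
  have hεR : ε * (R ^ 2 + 1) = u x₀ := by rw [hε]; field_simp
  obtain ⟨y, hyK, hy⟩ := hK.exists_isMaxOn ⟨x₀, hx₀⟩
    (f := u + ε • fun z : E => ‖z‖ ^ 2) (hu.add (by fun_prop))
  have hy0 : u x₀ + ε * ‖x₀‖ ^ 2 ≤ u y + ε * ‖y‖ ^ 2 := hy hx₀
  by_cases hyU : y ∈ U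
  · have hmax : IsLocalMax (u + ε • fun z : E => ‖z‖ ^ 2) y :=
      hy.isLocalMax (mem_of_superset (hU.mem_nhds hyU) hUK)
    have hq : ContDiffAt ℝ 2 (fun z : E => ‖z‖ ^ 2) y := (contDiff_norm_sq ℝ).contDiffAt
    have hq' : ContDiffAt ℝ 2 (ε • fun z : E => ‖z‖ ^ 2) y := hq.const_smul ε
    have h1 := laplacian_eq_sum_fderiv_fderiv (stdOrthonormalBasis ℝ E)
      (u + ε • fun z : E => ‖z‖ ^ 2) y
    have h2 : Δ (u + ε • fun z : E => ‖z‖ ^ 2) y = ε * (2 * Module.finrank ℝ E) := by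
      have h0 : Δ u y = 0 := (hΔ y hyU).2.self_of_nhds
      rw [(hΔ y hyU).1.laplacian_add hq', laplacian_smul ε hq, laplacian_norm_sq,
        h0, zero_add, smul_eq_mul]
    have h3 : 0 < ε * (2 * (Module.finrank ℝ E : ℝ)) := by
      have : 0 < Module.finrank ℝ E := Module.finrank_pos
      positivity
    have h4 := Finset.sum_nonpos fun i (_ : i ∈ Finset.univ) =>
      hmax.fderiv_fderiv_nonpos ((hΔ y hyU).1.add hq') (stdOrthonormalBasis ℝ E i)
    linarith
  · have h1 := hb y hyK hyU
    have h2 : ‖y‖ ^ 2 ≤ R ^ 2 := pow_le_pow_left₀ (norm_nonneg y) (hR y hyK) 2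
    nlinarith [mul_le_mul_of_nonneg_left h2 hε0.le, mul_nonneg hε0.le (sq_nonneg ‖x₀‖)]

theorem harmonicAt_half_ball_barrier (e : E) (he : ‖e‖ = 1) (s : ℝ) (x : E) :
    HarmonicAt (fun y : E => ‖y‖ ^ 2 +
      Module.finrank ℝ E * (inner ℝ e y * s - inner ℝ e y ^ 2)) x := by
  have c1 : ∀ y, ContDiffAt ℝ 2 (fun z : E => ‖z‖ ^ 2) y :=
    fun y => (contDiff_norm_sq ℝ).contDiffAt
  have c2 : ∀ y, ContDiffAt ℝ 2 (fun z : E => (inner ℝ e z : ℝ)) y :=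
    fun y => contDiffAt_const.inner ℝ contDiffAt_id
  have c3 : ∀ y, ContDiffAt ℝ 2 (fun z : E => (inner ℝ e z : ℝ) ^ 2) y := fun y => (c2 y).pow 2
  have heq : (fun y : E => ‖y‖ ^ 2 +
      Module.finrank ℝ E * (inner ℝ e y * s - inner ℝ e y ^ 2)) =
      (fun z : E => ‖z‖ ^ 2) + ((Module.finrank ℝ E : ℝ) • (s • (fun z : E => (inner ℝ e z : ℝ)) -
        fun z : E => (inner ℝ e z : ℝ) ^ 2)) := by
    ext y
    simp only [Pi.add_apply, Pi.smul_apply, Pi.sub_apply, smul_eq_mul]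
    ring
  rw [heq]
  have c4 : ∀ y, ContDiffAt ℝ 2 (s • fun z : E => (inner ℝ e z : ℝ)) y :=
    fun y => (c2 y).const_smul s
  have c6 : ∀ y, ContDiffAt ℝ 2
      (s • (fun z : E => (inner ℝ e z : ℝ)) - fun z : E => (inner ℝ e z : ℝ) ^ 2) y :=
    fun y => (c4 y).sub (c3 y)
  have c5 : ∀ y, ContDiffAt ℝ 2 ((Module.finrank ℝ E : ℝ) •
      (s • (fun z : E => (inner ℝ e z : ℝ)) - fun z : E => (inner ℝ e z : ℝ) ^ 2)) y :=
    fun y => (c6 y).const_smul (Module.finrank ℝ E : ℝ)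
  refine ⟨(c1 x).add (c5 x), ?_⟩
  filter_upwards with y
  rw [(c1 y).laplacian_add (c5 y), laplacian_smul _ (c6 y),
    (c4 y).laplacian_sub (c3 y), laplacian_smul _ (c2 y), laplacian_norm_sq, laplacian_inner,
    laplacian_inner_sq, he]
  simp
  ring

theorem fderiv_zero_apply_le_of_harmonic [Nontrivial E] {u : E → ℝ} {s M : ℝ} (hs : 0 < s)
    (hu : ∀ y ∈ closedBall (0 : E) s, HarmonicAt u y) (hM : ∀ y ∈ closedBall (0 : E) s, |u y| ≤ M)
    {e : E} (he : ‖e‖ = 1) : fderiv ℝ u 0 e ≤ Module.finrank ℝ E * M / s := by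
  set N : ℝ := (Module.finrank ℝ E : ℝ)
  set R := (ℝ ∙ e)ᗮ.reflection with hR
  have hM0 : 0 ≤ M := (abs_nonneg _).trans (hM 0 (by simp [hs.le]))
  set q : E → ℝ := fun y => ‖y‖ ^ 2 + N * (inner ℝ e y * s - inner ℝ e y ^ 2) with hq
  set v : E → ℝ := (u - fun y => u (0 + R y)) - (2 * M / s ^ 2) • q with hv
  have hRmem : ∀ y ∈ closedBall (0 : E) s, 0 + R y ∈ closedBall (0 : E) s := by
    intro y hy
    simpa using hy
  have hvh : ∀ y ∈ closedBall (0 : E) s, HarmonicAt v y := fun y hy =>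
    ((hu y hy).sub (hu _ (hRmem y hy)).comp_add_linearIsometryEquiv).sub
      ((harmonicAt_half_ball_barrier e he s y).const_smul)
  have hKc : IsClosed {y : E | 0 ≤ (inner ℝ e y : ℝ)} :=
    isClosed_le continuous_const (by fun_prop)
  have hUo : IsOpen {y : E | 0 < (inner ℝ e y : ℝ)} :=
    isOpen_lt continuous_const (by fun_prop)
  have key : ∀ y ∈ closedBall (0 : E) s ∩ {y : E | 0 ≤ (inner ℝ e y : ℝ)}, v y ≤ 0 := by
    refine harmonic_nonpos_of_boundary_nonpos
      (U := ball (0 : E) s ∩ {y : E | 0 < (inner ℝ e y : ℝ)})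
      ((isCompact_closedBall _ _).inter_right hKc) (isOpen_ball.inter hUo)
      (fun y hy => ⟨ball_subset_closedBall hy.1, show (0 : ℝ) ≤ inner ℝ e y from le_of_lt hy.2⟩)
      (fun y hy => (hvh y hy.1).1.continuousAt.continuousWithinAt)
      (fun y hy => hvh y (ball_subset_closedBall hy.1)) ?_
    rintro y ⟨hy1, hy2⟩ hyU
    have hy2' : 0 ≤ (inner ℝ e y : ℝ) := hy2
    have hys : ‖y‖ ≤ s := by simpa using hy1
    have hps : (inner ℝ e y : ℝ) ≤ s := by
      have := real_inner_le_norm e y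
      rw [he, one_mul] at this
      exact this.trans hys
    have hvy : v y = u y - u (0 + R y) - 2 * M / s ^ 2 * q y := rfl
    have hqy : ‖y‖ ^ 2 ≤ q y := by
      have h1 : 0 ≤ N * (inner ℝ e y * (s - inner ℝ e y)) := by
        have : 0 ≤ s - inner ℝ e y := by linarith
        positivity
      simp only [hq]
      nlinarith
    by_cases hlt : ‖y‖ < s
    · have hp0 : (inner ℝ e y : ℝ) = 0 := by
        by_contra hne
        exact hyU ⟨by simpa using hlt, lt_of_le_of_ne hy2' (Ne.symm hne)⟩
      have hRy : R y = y := reflection_orthogonal_span_eq_self hp0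
      rw [hvy, hRy, zero_add, sub_self, zero_sub, neg_nonpos]
      have : 0 ≤ q y := (sq_nonneg _).trans hqy
      positivity
    · have hys' : ‖y‖ = s := le_antisymm hys (not_lt.1 hlt)
      have h1 := (abs_le.1 (hM y hy1)).2
      have h2 := (abs_le.1 (hM _ (hRmem y hy1))).1
      have h3 : 2 * M ≤ 2 * M / s ^ 2 * q y := by
        calc 2 * M = 2 * M / s ^ 2 * ‖y‖ ^ 2 := by rw [hys']; field_simp
          _ ≤ _ := mul_le_mul_of_nonneg_left hqy (by positivity)
      rw [hvy]
      linarith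
  have hu0 : HasFDerivAt u (fderiv ℝ u 0) 0 :=
    ((hu 0 (by simp [hs.le])).1.differentiableAt (by simp)).hasFDerivAt
  have hd1 : HasDerivAt (fun t : ℝ => u (t • e)) (fderiv ℝ u 0 e) 0 := by
    have h0 : HasDerivAt (fun t : ℝ => t • e) e 0 := by
      simpa using hasDerivAt_add_smul (0 : E) e 0
    exact HasFDerivAt.comp_hasDerivAt (0 : ℝ) (by simpa using hu0) h0
  have hd2 : HasDerivAt (fun t : ℝ => u (-(t • e))) (-(fderiv ℝ u 0 e)) 0 := by
    have h0 : HasDerivAt (fun t : ℝ => -(t • e)) (-e) 0 := by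
      simpa using hasDerivAt_add_smul (0 : E) (-e) 0
    have := HasFDerivAt.comp_hasDerivAt (0 : ℝ) (f := fun t : ℝ => -(t • e)) (l := u)
      (l' := fderiv ℝ u 0) (by simpa using hu0) h0
    rw [map_neg] at this
    exact this
  have hd3 : HasDerivAt (fun t : ℝ => 2 * M / s ^ 2 * (t ^ 2 + N * (t * s - t ^ 2)))
      (2 * M / s ^ 2 * (N * s)) 0 := by
    have := (((hasDerivAt_pow 2 (0 : ℝ)).add ((((hasDerivAt_id (0 : ℝ)).mul_const s).sub
      (hasDerivAt_pow 2 (0 : ℝ))).const_mul N)).const_mul (2 * M / s ^ 2))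
    exact this.congr_deriv (by simp)
  have hd := ((hd1.sub hd2).sub hd3).tendsto_slope_zero_right
  have hle : fderiv ℝ u 0 e - -(fderiv ℝ u 0 e) - 2 * M / s ^ 2 * (N * s) ≤ 0 := by
    refine le_of_tendsto hd ?_
    filter_upwards [Ioo_mem_nhdsGT hs] with t ht
    have hin : inner ℝ e (t • e) = t := by
      rw [inner_smul_right, real_inner_self_eq_norm_sq, he]; ring
    have hnt : ‖t • e‖ = t := by
      rw [norm_smul, he, mul_one, Real.norm_of_nonneg ht.1.le]
    have h1 := key (t • e) ⟨by simpa [hnt] using ht.2.le, by simpa [hin] using ht.1.le⟩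
    have h2 : v (t • e) = u (t • e) - u (0 + R (t • e)) - 2 * M / s ^ 2 * q (t • e) := rfl
    have h3 : R (t • e) = -(t • e) := by
      rw [map_smul, hR, Submodule.reflection_orthogonalComplement_singleton_eq_neg, smul_neg]
    rw [h2, h3, zero_add] at h1
    simp only [hq, hin, hnt] at h1
    have h4 : (0 : ℝ) ≤ t⁻¹ := by have := ht.1; positivity
    simp only [smul_eq_mul]
    refine mul_nonpos_of_nonneg_of_nonpos h4 ?_
    simp
    linarith
  have : 2 * M / s ^ 2 * (N * s) = 2 * (N * M / s) := by field_simp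
  linarith

theorem norm_fderiv_le_of_harmonic [Nontrivial E] {u : E → ℝ} {c : E} {s M : ℝ} (hs : 0 < s)
    (hu : ∀ y ∈ closedBall c s, HarmonicAt u y) (hM : ∀ y ∈ closedBall c s, |u y| ≤ M) :
    ‖fderiv ℝ u c‖ ≤ Module.finrank ℝ E * M / s := by
  have hM0 : 0 ≤ M := (abs_nonneg _).trans (hM c (by simp [hs.le]))
  set g : E → ℝ := fun y => u (c + LinearIsometryEquiv.refl ℝ E y) with hg
  have hmem : ∀ y ∈ closedBall (0 : E) s, c + y ∈ closedBall c s := by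
    intro y hy; simpa using hy
  have hgd : fderiv ℝ g 0 = fderiv ℝ u c := by
    simp [hg, fderiv_comp_add_left]
  have hunit : ∀ e : E, ‖e‖ = 1 → fderiv ℝ u c e ≤ Module.finrank ℝ E * M / s := by
    intro e he
    rw [← hgd]
    exact fderiv_zero_apply_le_of_harmonic hs
      (fun y hy => (hu _ (hmem y hy)).comp_add_linearIsometryEquiv (R := .refl ℝ E))
      (fun y hy => hM _ (hmem y hy)) he
  refine ContinuousLinearMap.opNorm_le_bound _ (by positivity) fun w => ?_
  rcases eq_or_ne w 0 with rfl | hw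
  · simp
  have hw' : 0 < ‖w‖ := norm_pos_iff.2 hw
  have h1 := hunit (‖w‖⁻¹ • w) (by rw [norm_smul]; simp [hw'.ne'])
  have h2 := hunit (-(‖w‖⁻¹ • w)) (by rw [norm_neg, norm_smul]; simp [hw'.ne'])
  rw [map_neg] at h2
  rw [map_smul, smul_eq_mul] at h1 h2
  have e1 : fderiv ℝ u c w = ‖w‖ * (‖w‖⁻¹ * fderiv ℝ u c w) := by field_simp
  rw [Real.norm_eq_abs, abs_le]
  constructor <;> nlinarith

theorem harmonic_le_of_le_compl [Nontrivial E] {U : Set E} (hU : IsOpen U)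
    (hUb : Bornology.IsBounded U) {u : E → ℝ} {c : ℝ} (hu : Continuous u)
    (hΔ : ∀ x ∈ U, HarmonicAt u x) (hb : ∀ x ∉ U, u x ≤ c) (x : E) : u x ≤ c := by
  by_cases hx : x ∈ U
  · have := harmonic_nonpos_of_boundary_nonpos (u := u - fun _ => c) hUb.isCompact_closure hU
      subset_closure (hu.sub continuous_const).continuousOn
      (fun y hy => (hΔ y hy).sub (harmonicAt_const c))
      (fun y _ hy => by simpa using hb y hy) x (subset_closure hx)
    simpa using this
  · exact hb x hx

theorem harmonic_nonpos_on_annulus [Nontrivial E] {a b : ℝ} {u : E → ℝ}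
    (hu : ∀ y, a ≤ ‖y‖ → ‖y‖ ≤ b → ContinuousAt u y)
    (hΔ : ∀ y, a < ‖y‖ → ‖y‖ < b → HarmonicAt u y)
    (ha : ∀ y, ‖y‖ = a → u y ≤ 0) (hb : ∀ y, ‖y‖ = b → u y ≤ 0) {x : E}
    (h1 : a ≤ ‖x‖) (h2 : ‖x‖ ≤ b) : u x ≤ 0 := by
  refine harmonic_nonpos_of_boundary_nonpos (K := closedBall 0 b ∩ {y | a ≤ ‖y‖})
    (U := ball 0 b ∩ {y | a < ‖y‖}) ((isCompact_closedBall _ _).inter_right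
      (isClosed_le continuous_const continuous_norm))
    (isOpen_ball.inter (isOpen_lt continuous_const continuous_norm))
    (fun y hy => ⟨ball_subset_closedBall hy.1, show a ≤ ‖y‖ from le_of_lt hy.2⟩)
    (fun y hy => (hu y hy.2 (by simpa using hy.1)).continuousWithinAt)
    (fun y hy => hΔ y hy.2 (by simpa using hy.1)) ?_ x ⟨by simpa using h2, h1⟩
  rintro y ⟨hy1, hy2⟩ hyU
  have hy2' : a ≤ ‖y‖ := hy2
  have hy1' : ‖y‖ ≤ b := by simpa using hy1
  rcases hy2'.eq_or_lt with h | h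
  · exact ha y h.symm
  · refine hb y (hy1'.antisymm (not_lt.1 fun hlt => hyU ⟨by simpa using hlt, h⟩))

theorem harmonic_exterior_le (hn : 3 ≤ Module.finrank ℝ E) {G : E → ℝ} {d : ℝ} (hd : 0 < d)
    (hG : Continuous G) (hΔ : ∀ y, d < ‖y‖ → HarmonicAt G y) (h1 : ∀ y, G y ≤ 1)
    (hlim : Tendsto G (cocompact E) (𝓝 0)) {x : E} (hx : d ≤ ‖x‖) :
    G x ≤ (d / ‖x‖) ^ (Module.finrank ℝ E - 2) := by
  have : Nontrivial E := Module.nontrivial_of_finrank_pos (R := ℝ) (by omega)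
  set n := Module.finrank ℝ E with hn_def
  have hrp : ∀ y : E, y ≠ 0 →
      d ^ (n - 2) * (‖y‖ ^ 2) ^ (1 - (n : ℝ) / 2) = (d / ‖y‖) ^ (n - 2) := by
    intro y hy
    have hy' : 0 < ‖y‖ := norm_pos_iff.2 hy
    rw [← Real.rpow_natCast ‖y‖ 2, ← Real.rpow_mul hy'.le,
      show ((2 : ℕ) : ℝ) * (1 - (n : ℝ) / 2) = -((n - 2 : ℕ) : ℝ) by
        rw [Nat.cast_sub (by omega)]; push_cast; ring,
      Real.rpow_neg hy'.le, Real.rpow_natCast, div_pow, div_eq_mul_inv]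
  refine le_of_forall_pos_le_add fun ε hε => ?_
  obtain ⟨r, hr⟩ : ∃ r : ℝ, ∀ y : E, r < ‖y‖ → G y ≤ ε := by
    have h := hlim.eventually (ge_mem_nhds hε)
    rw [← cobounded_eq_cocompact, ← comap_norm_atTop, eventually_comap] at h
    obtain ⟨r, hr⟩ := eventually_atTop.1 h
    exact ⟨r, fun y hy => hr ‖y‖ hy.le y rfl⟩
  set b := max (r + 1) ‖x‖
  have hne : ∀ y : E, d ≤ ‖y‖ → y ≠ 0 := fun y hy => norm_pos_iff.1 (hd.trans_le hy)
  set u : E → ℝ := (G - fun _ => ε) -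
    d ^ (n - 2) • fun y : E => (‖y‖ ^ 2) ^ (1 - (n : ℝ) / 2) with hu
  have huv : ∀ y, d ≤ ‖y‖ → u y = G y - ε - (d / ‖y‖) ^ (n - 2) := fun y hy => by
    rw [← hrp y (hne y hy)]; rfl
  have key : u x ≤ 0 := by
    refine harmonic_nonpos_on_annulus (a := d) (b := b) ?_ ?_ ?_ ?_ hx (le_max_right _ _)
    · intro y hy _
      exact (hG.continuousAt.sub continuousAt_const).sub
        ((harmonicAt_norm_sq_rpow (hne y hy)).1.continuousAt.const_smul _)
    · intro y hy _
      exact ((hΔ y hy).sub (harmonicAt_const ε)).sub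
        (harmonicAt_norm_sq_rpow (hne y hy.le)).const_smul
    · intro y hy
      rw [huv y hy.ge, hy, div_self hd.ne', one_pow]
      linarith [h1 y]
    · intro y hy
      have hdy : d ≤ ‖y‖ := by rw [hy]; exact hx.trans (le_max_right _ _)
      rw [huv y hdy]
      have h2 := hr y (by rw [hy]; exact (lt_add_one r).trans_le (le_max_left _ _))
      have : 0 ≤ (d / ‖y‖) ^ (n - 2) := by positivity
      linarith
  rw [huv x hx] at key
  linarith

theorem harmonic_exterior_decay (hn : 3 ≤ Module.finrank ℝ E) {G : E → ℝ} {d : ℝ} (hd : 0 < d)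
    (hG : Continuous G) (hΔ : ∀ y, d < ‖y‖ → HarmonicAt G y) (h1 : ∀ y, |G y| ≤ 1)
    (hlim : Tendsto G (cocompact E) (𝓝 0)) {x : E} (hx : d ≤ ‖x‖) :
    |G x| ≤ (d / ‖x‖) ^ (Module.finrank ℝ E - 2) := by
  refine abs_le'.2 ⟨harmonic_exterior_le hn hd hG hΔ (fun y => (abs_le.1 (h1 y)).2) hlim hx, ?_⟩
  refine harmonic_exterior_le (G := fun y => -G y) hn hd hG.neg (fun y hy => ?_)
    (fun y => by linarith [(abs_le.1 (h1 y)).1]) (by simpa using hlim.neg) hx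
  have := (hΔ y hy).const_smul (c := (-1 : ℝ))
  rwa [neg_one_smul] at this

theorem harmonic_annulus_le_log (hE : Module.finrank ℝ E = 2) {G : E → ℝ} {d : ℝ} (hd : 0 < d)
    (hd1 : d < 1) (hG : Continuous G) (hΔ : ∀ y, d < ‖y‖ → ‖y‖ < 1 → HarmonicAt G y)
    (h1 : ∀ y, G y ≤ 1) (h0 : ∀ y, ‖y‖ = 1 → G y = 0) {x : E} (hx : d ≤ ‖x‖) (hx1 : ‖x‖ ≤ 1) :
    G x ≤ Real.log ‖x‖ / Real.log d := by
  have : Nontrivial E := Module.nontrivial_of_finrank_pos (R := ℝ) (by omega)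
  have hne : ∀ y : E, d ≤ ‖y‖ → y ≠ 0 := fun y hy => norm_pos_iff.1 (hd.trans_le hy)
  have hlog : Real.log d < 0 := Real.log_neg hd hd1
  set u : E → ℝ := G - (2 * Real.log d)⁻¹ • fun y : E => Real.log (‖y‖ ^ 2) with hu
  have huv : ∀ y, u y = G y - Real.log ‖y‖ / Real.log d := fun y => by
    simp only [hu, Pi.sub_apply, Pi.smul_apply, smul_eq_mul, Real.log_pow]
    push_cast
    field_simp
  have key : u x ≤ 0 := by
    refine harmonic_nonpos_on_annulus (a := d) (b := 1) ?_ ?_ ?_ ?_ hx hx1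
    · intro y hy _
      exact hG.continuousAt.sub
        ((harmonicAt_log_norm_sq hE (hne y hy)).1.continuousAt.const_smul _)
    · intro y hy hy1
      exact (hΔ y hy hy1).sub (harmonicAt_log_norm_sq hE (hne y hy.le)).const_smul
    · intro y hy
      rw [huv, hy, div_self hlog.ne]
      linarith [h1 y]
    · intro y hy
      rw [huv, hy, h0 y hy]
      simp
  rw [huv] at key
  linarith

theorem harmonic_annulus_oscillation (hE : Module.finrank ℝ E = 2) {G : E → ℝ} {d : ℝ}
    (hd : 0 < d) (hd1 : 4 * d ≤ 1) (hG : Continuous G)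
    (hΔ : ∀ y, d < ‖y‖ → ‖y‖ < 1 → HarmonicAt G y) (hG0 : ∀ y, 0 ≤ G y) (h1 : ∀ y, G y ≤ 1)
    (h0 : ∀ y, ‖y‖ = 1 → G y = 0) {x y : E} (hx : 2 * d ≤ ‖x‖) (hx1 : ‖x‖ ≤ 1)
    (hxy : ‖x‖ = ‖y‖) : G x - G y ≤ 64 * d / ‖x‖ := by
  have : Nontrivial E := Module.nontrivial_of_finrank_pos (R := ℝ) (by omega)
  rcases eq_or_ne x y with rfl | hne
  · rw [sub_self]; positivity
  set w := x - y with hw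
  have hw0 : 0 < ‖w‖ := norm_pos_iff.2 (sub_ne_zero.2 hne)
  set R := (ℝ ∙ w)ᗮ.reflection with hR
  have hRx : R x = y := Submodule.reflection_sub hxy
  have hx0 : 0 < ‖x‖ := by linarith
  have hwx : 0 ≤ (inner ℝ w x : ℝ) := by
    have h2 : ‖y‖ ^ 2 = ‖x‖ ^ 2 - 2 * inner ℝ x w + ‖w‖ ^ 2 := by
      rw [← norm_sub_sq_real, hw, sub_sub_cancel]
    rw [← hxy, real_inner_comm] at h2
    nlinarith [sq_nonneg ‖w‖]
  have hnez : ∀ z : E, 2 * d ≤ ‖z‖ → z ≠ 0 := fun z hz => norm_pos_iff.1 (by linarith)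
  set v : E → ℝ := (G - fun z => G (0 + R z)) -
    (64 * d / ‖w‖) • fun z : E => inner ℝ w z * (‖z‖ ^ 2)⁻¹ with hv
  have hvz : ∀ z, v z = G z - G (R z) - 64 * d / ‖w‖ * (inner ℝ w z * (‖z‖ ^ 2)⁻¹) := fun z => by
    simp [hv]
  have key : v x ≤ 0 := by
    refine harmonic_nonpos_of_boundary_nonpos
      (K := closedBall 0 1 ∩ {z | 2 * d ≤ ‖z‖} ∩ {z | 0 ≤ (inner ℝ w z : ℝ)})
      (U := ball 0 1 ∩ {z | 2 * d < ‖z‖} ∩ {z | 0 < (inner ℝ w z : ℝ)})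
      (((isCompact_closedBall _ _).inter_right
        (isClosed_le continuous_const continuous_norm)).inter_right
        (isClosed_le continuous_const (by fun_prop)))
      ((isOpen_ball.inter (isOpen_lt continuous_const continuous_norm)).inter
        (isOpen_lt continuous_const (by fun_prop)))
      ?_ ?_ ?_ ?_ x ⟨⟨by simpa using hx1, hx⟩, hwx⟩
    · rintro z ⟨⟨h1, h2⟩, h3⟩
      exact ⟨⟨ball_subset_closedBall h1, show 2 * d ≤ ‖z‖ from le_of_lt h2⟩,
        show (0 : ℝ) ≤ inner ℝ w z from le_of_lt h3⟩
    · rintro z ⟨⟨_, h2⟩, _⟩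
      exact ((hG.continuousAt.sub (hG.comp (by fun_prop)).continuousAt).sub
        ((harmonicAt_inner_div_norm_sq hE w (hnez z h2)).1.continuousAt.const_smul
          _)).continuousWithinAt
    · rintro z ⟨⟨h1, h2⟩, _⟩
      have h1' : ‖z‖ < 1 := by simpa using h1
      have h2' : 2 * d < ‖z‖ := h2
      refine ((hΔ z (by linarith) h1').sub
        (HarmonicAt.comp_add_linearIsometryEquiv (hΔ _ ?_ ?_))).sub
        (harmonicAt_inner_div_norm_sq hE w (hnez z h2'.le)).const_smul
      · simp only [zero_add, LinearIsometryEquiv.norm_map]; linarith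
      · simpa using h1'
    · rintro z ⟨⟨hz1, hz2⟩, hz3⟩ hzU
      have hz1' : ‖z‖ ≤ 1 := by simpa using hz1
      have hz2' : 2 * d ≤ ‖z‖ := hz2
      have hz3' : 0 ≤ (inner ℝ w z : ℝ) := hz3
      have hB : 0 ≤ 64 * d / ‖w‖ * (inner ℝ w z * (‖z‖ ^ 2)⁻¹) := by positivity
      rw [hvz]
      rcases hz3'.eq_or_lt with h3 | h3
      · rw [show R z = z from reflection_orthogonal_span_eq_self h3.symm]
        linarith
      rcases hz1'.eq_or_lt with h4 | h4
      · rw [h0 z h4, h0 (R z) (by rw [LinearIsometryEquiv.norm_map, h4])]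
        linarith
      have hzd : ‖z‖ = 2 * d :=
        le_antisymm (not_lt.1 fun h => hzU ⟨⟨by simpa using h4, h⟩, h3⟩) hz2'
      set p : ℝ := inner ℝ w z / ‖w‖ with hp
      have hp0 : 0 ≤ p := by positivity
      have hBp : 64 * d / ‖w‖ * (inner ℝ w z * (‖z‖ ^ 2)⁻¹) = 16 * p / d := by
        rw [hzd, hp]; field_simp; norm_num
      rw [hBp]
      have hdist : ‖z - R z‖ = 2 * p := by
        rw [hR, norm_sub_reflection, abs_of_nonneg hz3']
      rcases le_or_gt (d / 4) p with hpd | hpd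
      · have : 1 ≤ 16 * p / d := by rw [le_div_iff₀ hd]; linarith
        linarith [h1 z, hG0 (R z)]
      · have hgrad : ∀ c ∈ closedBall z (d / 2), DifferentiableAt ℝ G c ∧
            ‖fderiv ℝ G c‖ ≤ 8 / d := by
          intro c hc
          have hcz : ‖c - z‖ ≤ d / 2 := by simpa [dist_eq_norm] using hc
          have hball : ∀ y ∈ closedBall c (d / 4), HarmonicAt G y := by
            intro y hy
            have hyc : ‖y - c‖ ≤ d / 4 := by simpa [dist_eq_norm] using hy
            have hyz : ‖y - z‖ ≤ 3 * d / 4 := by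
              have := norm_add_le (y - c) (c - z)
              rw [sub_add_sub_cancel] at this
              linarith
            have l1 := norm_sub_norm_le z y
            have l2 := norm_sub_norm_le y z
            rw [norm_sub_rev] at l1
            exact hΔ y (by linarith) (by linarith)
          refine ⟨(hball c (mem_closedBall_self (by positivity))).1.differentiableAt (by simp), ?_⟩
          have := norm_fderiv_le_of_harmonic (M := 1) (by positivity : 0 < d / 4) hball
            (fun y _ => abs_le.2 ⟨by linarith [hG0 y], h1 y⟩)
          rw [hE] at this
          refine this.trans (le_of_eq ?_)
          field_simp; norm_num
        have := (convex_closedBall z (d / 2)).norm_image_sub_le_of_norm_fderiv_le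
          (fun c hc => (hgrad c hc).1) (fun c hc => (hgrad c hc).2)
          (x := R z) (y := z) (by rw [mem_closedBall, dist_comm, dist_eq_norm, hdist]; linarith)
          (mem_closedBall_self (by positivity))
        rw [hdist, Real.norm_eq_abs] at this
        have h5 := (abs_le.1 this).2
        have : 8 / d * (2 * p) = 16 * p / d := by ring
        linarith
  rw [hvz, hRx] at key
  have hin : (inner ℝ w x : ℝ) ≤ ‖w‖ * ‖x‖ := real_inner_le_norm w x
  have : 64 * d / ‖w‖ * (inner ℝ w x * (‖x‖ ^ 2)⁻¹) ≤ 64 * d / ‖x‖ := by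
    calc 64 * d / ‖w‖ * (inner ℝ w x * (‖x‖ ^ 2)⁻¹)
        ≤ 64 * d / ‖w‖ * (‖w‖ * ‖x‖ * (‖x‖ ^ 2)⁻¹) := by gcongr
      _ = 64 * d / ‖x‖ := by field_simp
  linarith

theorem harmonic_annulus_gradient_inner (hE : Module.finrank ℝ E = 2) {G : E → ℝ} {d : ℝ}
    (hd : 0 < d) (hG : Continuous G)
    (hΔ : ∀ y, d < ‖y‖ → ‖y‖ < 1 → HarmonicAt G y) (hG0 : ∀ y, 0 ≤ G y) (h1 : ∀ y, G y ≤ 1)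
    (h0 : ∀ y, ‖y‖ = 1 → G y = 0) {x : E} (hx : 4 * d ≤ ‖x‖) (hx1 : ‖x‖ ≤ 1 / 4) :
    ‖fderiv ℝ G x‖ ≤ 8 * (128 * d / ‖x‖ + (-Real.log d)⁻¹) / ‖x‖ := by
  have : Nontrivial E := Module.nontrivial_of_finrank_pos (R := ℝ) (by omega)
  set r := ‖x‖ with hr
  have hr0 : 0 < r := by linarith
  set ε := 128 * d / r with hε
  have hd1 : d < 1 := by linarith
  have hlogd : Real.log d < 0 := Real.log_neg hd hd1
  have hlogr : Real.log (r / 2) < 0 := Real.log_neg (by linarith) (by linarith)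
  set z : E := (1 / 2 : ℝ) • x with hz
  have hzr : ‖z‖ = r / 2 := by rw [hz, norm_smul, ← hr]; norm_num; ring
  set a := G z / Real.log (r / 2) with ha
  have hεr : 64 * d / (r / 2) = ε := by rw [hε]; field_simp; norm_num
  have haL : |a| ≤ (-Real.log d)⁻¹ := by
    have h := harmonic_annulus_le_log hE hd hd1 hG hΔ h1 h0 (x := z) (by rw [hzr]; linarith)
      (by rw [hzr]; linarith)
    rw [hzr] at h
    rw [ha, abs_div, abs_of_nonneg (hG0 z), abs_of_neg hlogr, div_le_iff₀ (by linarith)]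
    refine h.trans (le_of_eq ?_)
    field_simp
  have hosc : ∀ y y' : E, ‖y‖ = r / 2 → ‖y'‖ = r / 2 → G y - G y' ≤ ε := by
    intro y y' hy hy'
    have := harmonic_annulus_oscillation hE hd (by linarith) hG hΔ hG0 h1 h0 (x := y) (y := y')
      (by rw [hy]; linarith) (by rw [hy]; linarith) (by rw [hy, hy'])
    rwa [hy, hεr] at this
  have haz : a * Real.log (r / 2) = G z := by
    rw [ha, div_mul_cancel₀ _ hlogr.ne]
  have hcomp : ∀ σ : ℝ, |σ| = 1 → ∀ y : E, r / 2 ≤ ‖y‖ → ‖y‖ ≤ 1 →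
      σ * (G y - a * Real.log ‖y‖) ≤ ε := by
    intro σ hσ y hy hy1
    have hε0 : 0 < ε := by positivity
    have hne : ∀ y : E, r / 2 ≤ ‖y‖ → y ≠ 0 := fun y hy => norm_pos_iff.1 (by linarith)
    set u : E → ℝ := σ • (G - (a / 2) • fun y : E => Real.log (‖y‖ ^ 2)) - fun _ => ε with hu
    have huv : ∀ y, u y = σ * (G y - a * Real.log ‖y‖) - ε := fun y => by
      simp only [hu, Pi.sub_apply, Pi.smul_apply, smul_eq_mul, Real.log_pow]
      push_cast
      ring
    have key : u y ≤ 0 := by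
      refine harmonic_nonpos_on_annulus (a := r / 2) (b := 1) ?_ ?_ ?_ ?_ hy hy1
      · intro y hy _
        exact ((hG.continuousAt.sub ((harmonicAt_log_norm_sq hE
          (hne y hy)).1.continuousAt.const_smul _)).const_smul _).sub continuousAt_const
      · intro y hy hy1
        exact ((hΔ y (by linarith) hy1).sub
          (harmonicAt_log_norm_sq hE (hne y hy.le)).const_smul).const_smul.sub
          (harmonicAt_const ε)
      · intro y hy
        rw [huv, hy, haz]
        have h1 := hosc y z hy hzr
        have h2 := hosc z y hzr hy
        have h3 : |σ * (G y - G z)| ≤ ε := by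
          rw [abs_mul, hσ, one_mul]; exact abs_le.2 ⟨by linarith, h1⟩
        linarith [le_abs_self (σ * (G y - G z))]
      · intro y hy
        rw [huv, hy, h0 y hy]
        simp [hε0.le]
    rw [huv] at key
    linarith
  have hball : ∀ y ∈ closedBall x (r / 4), 3 / 4 * r ≤ ‖y‖ ∧ ‖y‖ ≤ 5 / 4 * r := by
    intro y hy
    have hyx : ‖y - x‖ ≤ r / 4 := by simpa [dist_eq_norm] using hy
    have l1 := norm_sub_norm_le x y
    have l2 := norm_sub_norm_le y x
    rw [norm_sub_rev] at l1
    constructor <;> linarith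
  have hmain := norm_fderiv_le_of_harmonic (u := G - fun _ => a * Real.log r) (c := x)
    (s := r / 4) (M := ε + (-Real.log d)⁻¹) (by positivity)
    (fun y hy => (hΔ y (by linarith [(hball y hy).1]) (by linarith [(hball y hy).2])).sub
      (harmonicAt_const _)) ?_
  · have hfd : fderiv ℝ (G - fun _ => a * Real.log r) x = fderiv ℝ G x :=
      fderiv_sub_const (a * Real.log r)
    rw [hfd, hE] at hmain
    refine hmain.trans (le_of_eq ?_)
    field_simp
    push_cast
    ring
  · intro y hy
    obtain ⟨b1, b2⟩ := hball y hy
    have hy0 : 0 < ‖y‖ := by linarith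
    have k1 := hcomp 1 (by simp) y (by linarith) (by linarith)
    have k2 := hcomp (-1) (by simp) y (by linarith) (by linarith)
    have k3 : |G y - a * Real.log ‖y‖| ≤ ε := abs_le.2 ⟨by linarith, by linarith⟩
    have k4 : |Real.log ‖y‖ - Real.log r| ≤ 1 := by
      rw [← Real.log_div hy0.ne' hr0.ne']
      have t1 : ‖y‖ / r ≤ 5 / 4 := by rw [div_le_iff₀ hr0]; linarith
      have t2 : r / ‖y‖ ≤ 4 / 3 := by rw [div_le_iff₀ hy0]; linarith
      have t3 := Real.log_le_sub_one_of_pos (div_pos hy0 hr0)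
      have t4 := Real.log_le_sub_one_of_pos (div_pos hr0 hy0)
      have t5 : Real.log (r / ‖y‖) = -Real.log (‖y‖ / r) := by rw [← Real.log_inv, inv_div]
      exact abs_le.2 ⟨by linarith, by linarith⟩
    have k5 : (G - fun _ => a * Real.log r : E → ℝ) y =
        (G y - a * Real.log ‖y‖) + a * (Real.log ‖y‖ - Real.log r) := by
      simp only [Pi.sub_apply]; ring
    rw [k5]
    refine (abs_add_le _ _).trans (add_le_add k3 ?_)
    rw [abs_mul]
    nlinarith [abs_nonneg a]

theorem harmonic_annulus_gradient_outer (hE : Module.finrank ℝ E = 2) {G : E → ℝ} {d : ℝ}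
    (hd : 0 < d) (hd1 : d < 1 / 16) (hG : Continuous G)
    (hΔ : ∀ y, d < ‖y‖ → ‖y‖ < 1 → HarmonicAt G y) (hG0 : ∀ y, 0 ≤ G y) (h1 : ∀ y, G y ≤ 1)
    (h0 : ∀ y, ‖y‖ = 1 → G y = 0) {x : E} (hx : 1 / 4 ≤ ‖x‖) (hx1 : ‖x‖ < 1) :
    ‖fderiv ℝ G x‖ ≤ 160 * (-Real.log d)⁻¹ := by
  have : Nontrivial E := Module.nontrivial_of_finrank_pos (R := ℝ) (by omega)
  set r := ‖x‖ with hr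
  have hlogd : 0 < -Real.log d := neg_pos.2 (Real.log_neg hd (by linarith))
  have hball : ∀ y ∈ closedBall x ((1 - r) / 4), 1 / 16 ≤ ‖y‖ ∧ 1 - ‖y‖ ≤ 5 / 4 * (1 - r) ∧
      ‖y‖ < 1 := by
    intro y hy
    have hyx : ‖y - x‖ ≤ (1 - r) / 4 := by simpa [dist_eq_norm] using hy
    have l1 := norm_sub_norm_le x y
    have l2 := norm_sub_norm_le y x
    rw [norm_sub_rev] at l1
    refine ⟨?_, ?_, ?_⟩ <;> linarith
  have hmain := norm_fderiv_le_of_harmonic (u := G) (c := x)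
    (s := (1 - r) / 4) (M := 20 * (1 - r) * (-Real.log d)⁻¹) (by linarith)
    (fun y hy => hΔ y (by linarith [(hball y hy).1]) (hball y hy).2.2) ?_
  · rw [hE] at hmain
    refine hmain.trans (le_of_eq ?_)
    have : 1 - r ≠ 0 := by linarith
    field_simp
    norm_num
  · intro y hy
    obtain ⟨b1, b2, b3⟩ := hball y hy
    have hy0 : 0 < ‖y‖ := by linarith
    rw [abs_of_nonneg (hG0 y)]
    refine (harmonic_annulus_le_log hE hd (by linarith) hG hΔ h1 h0 (x := y) (by linarith)
      b3.le).trans ?_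
    have e : Real.log ‖y‖ / Real.log d = -Real.log ‖y‖ * (-Real.log d)⁻¹ := by
      rw [inv_neg]; ring
    rw [e]
    refine mul_le_mul_of_nonneg_right ?_ (by positivity)
    have t := Real.log_le_sub_one_of_pos (inv_pos.2 hy0)
    rw [Real.log_inv] at t
    have t2 : ‖y‖⁻¹ - 1 = (1 - ‖y‖) * ‖y‖⁻¹ := by field_simp
    have t3 : ‖y‖⁻¹ ≤ 16 := by
      rw [inv_le_comm₀ hy0 (by norm_num)]; linarith
    have t4 : (1 - ‖y‖) * ‖y‖⁻¹ ≤ (1 - ‖y‖) * 16 :=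
      mul_le_mul_of_nonneg_left t3 (by linarith)
    linarith

end HarmonicTools

section CapacityPotential

open InnerProductSpace Laplacian

theorem lap_eq_laplacian {n : ℕ} {H : Euc n → ℝ} {x : Euc n} (hH : ContDiffAt ℝ 2 H x) :
    lap H x = Δ H x := by
  rw [laplacian_eq_sum_fderiv_fderiv (EuclideanSpace.basisFun (Fin n) ℝ), lap]
  refine Finset.sum_congr rfl fun j _ => ?_
  have h1 : DifferentiableAt ℝ (fderiv ℝ H) x :=
    (hH.fderiv_right (m := 1) (by norm_num)).differentiableAt (by norm_num)
  rw [fderiv_clm_apply h1 (differentiableAt_const _)]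
  simp [ebasis]

theorem harmonicAt_of_lap_eq_zero {n : ℕ} {H : Euc n → ℝ} {Ω : Set (Euc n)} (hΩ : IsOpen Ω)
    (hH : ContDiffOn ℝ 2 H Ω) (h0 : ∀ y ∈ Ω, lap H y = 0) {x : Euc n} (hx : x ∈ Ω) :
    HarmonicAt H x := by
  refine ⟨hH.contDiffAt (hΩ.mem_nhds hx), ?_⟩
  filter_upwards [hΩ.mem_nhds hx] with y hy
  rw [← lap_eq_laplacian (hH.contDiffAt (hΩ.mem_nhds hy)), h0 y hy]
  rfl

theorem infDist_closedBall_eq {n : ℕ} {x₀ x : Euc n} {d : ℝ} (hd : 0 ≤ d)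
    (hx : x ∉ closedBall x₀ d) : infDist x (closedBall x₀ d) = ‖x - x₀‖ - d := by
  have hx' : d < ‖x - x₀‖ := by simpa [dist_eq_norm] using hx
  have hr : 0 < ‖x - x₀‖ := hd.trans_lt hx'
  refine le_antisymm ?_ ?_
  · have hmem : x₀ + (d / ‖x - x₀‖) • (x - x₀) ∈ closedBall x₀ d := by
      rw [mem_closedBall, dist_eq_norm, add_sub_cancel_left, norm_smul, Real.norm_eq_abs,
        abs_of_nonneg (by positivity), div_mul_cancel₀ _ hr.ne']
    refine (infDist_le_dist_of_mem hmem).trans (le_of_eq ?_)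
    have : x - (x₀ + (d / ‖x - x₀‖) • (x - x₀)) = (1 - d / ‖x - x₀‖) • (x - x₀) := by
      rw [sub_smul, one_smul]; abel
    rw [dist_eq_norm, this, norm_smul, Real.norm_eq_abs, abs_of_nonneg, sub_mul, one_mul,
      div_mul_cancel₀ _ hr.ne']
    rw [sub_nonneg, div_le_one hr]
    exact hx'.le
  · refine (le_infDist ⟨x₀, mem_closedBall_self hd⟩).2 fun y hy => ?_
    have h1 := dist_triangle x y x₀
    rw [← dist_eq_norm]
    linarith [mem_closedBall.1 hy]

theorem harmonicAt_translate {n : ℕ} {H : Euc n → ℝ} {x₀ y : Euc n}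
    (h : HarmonicAt H (x₀ + y)) : HarmonicAt (fun z => H (x₀ + z)) y :=
  HarmonicAt.comp_add_linearIsometryEquiv (R := LinearIsometryEquiv.refl ℝ (Euc n)) h

theorem IsCapPotential.harmonicAt {n : ℕ} {D : Set (Euc n)} {H : Euc n → ℝ}
    (hH : IsCapPotential D H) {x : Euc n} (hx : x ∉ closure D) : HarmonicAt H x :=
  harmonicAt_of_lap_eq_zero isClosed_closure.isOpen_compl hH.2.2.1 hH.2.2.2.1 hx

theorem IsCapPotential.abs_le_one {n : ℕ} (hn : 0 < n) {D : Set (Euc n)} {H : Euc n → ℝ}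
    (hH : IsCapPotential D H) (x : Euc n) : |H x| ≤ 1 := by
  have : Nontrivial (Euc n) := Module.nontrivial_of_finrank_pos (R := ℝ) (by simpa using hn)
  obtain ⟨r, hr⟩ : ∃ r : ℝ, ∀ y : Euc n, r ≤ ‖y‖ → |H y| ≤ 1 := by
    have h := (tendsto_zero_iff_abs_tendsto_zero H).1 hH.2.2.2.2 |>.eventually
      (ge_mem_nhds zero_lt_one)
    rw [← cobounded_eq_cocompact, ← comap_norm_atTop, eventually_comap] at h
    obtain ⟨r, hr⟩ := eventually_atTop.1 h
    exact ⟨r, fun y hy => hr ‖y‖ hy y rfl⟩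
  have hU : IsOpen (ball (0 : Euc n) r \ closure D) := isOpen_ball.sdiff isClosed_closure
  have hUb : Bornology.IsBounded (ball (0 : Euc n) r \ closure D) :=
    isBounded_ball.subset sdiff_subset
  have hb : ∀ y ∉ ball (0 : Euc n) r \ closure D, |H y| ≤ 1 := by
    intro y hy
    by_cases hyD : y ∈ closure D
    · rw [hH.2.1 y hyD, abs_one]
    · exact hr y (not_lt.1 fun h => hy ⟨by simpa using h, hyD⟩)
  refine abs_le'.2 ⟨harmonic_le_of_le_compl hU hUb hH.1 (fun y hy => hH.harmonicAt hy.2)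
    (fun y hy => (abs_le'.1 (hb y hy)).1) x,
    harmonic_le_of_le_compl (u := fun y => -H y) hU hUb hH.1.neg (fun y hy => ?_)
    (fun y hy => (abs_le'.1 (hb y hy)).2) x⟩
  have := (hH.harmonicAt hy.2).const_smul (c := (-1 : ℝ))
  rwa [neg_one_smul] at this

theorem IsCapPotentialRel.harmonicAt {n : ℕ} {x₀ : Euc n} {D : Set (Euc n)} {H : Euc n → ℝ}
    (hH : IsCapPotentialRel x₀ D H) {x : Euc n} (hx : x ∈ ball x₀ 1 \ closure D) :
    HarmonicAt H x :=
  harmonicAt_of_lap_eq_zero (isOpen_ball.sdiff isClosed_closure) hH.2.2.1 hH.2.2.2.1 hx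

theorem IsCapPotentialRel.mem_Icc {n : ℕ} (hn : 0 < n) {x₀ : Euc n} {D : Set (Euc n)}
    {H : Euc n → ℝ} (hH : IsCapPotentialRel x₀ D H) (x : Euc n) : H x ∈ Icc (0 : ℝ) 1 := by
  have : Nontrivial (Euc n) := Module.nontrivial_of_finrank_pos (R := ℝ) (by simpa using hn)
  have hU : IsOpen (ball x₀ 1 \ closure D) := isOpen_ball.sdiff isClosed_closure
  have hUb : Bornology.IsBounded (ball x₀ 1 \ closure D) := isBounded_ball.subset sdiff_subset
  have hb : ∀ y ∉ ball x₀ 1 \ closure D, H y ∈ Icc (0 : ℝ) 1 := by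
    intro y hy
    by_cases hyD : y ∈ closure D
    · simp [hH.2.1 y hyD]
    · simp [hH.2.2.2.2 y fun h => hy ⟨h, hyD⟩]
  refine ⟨?_, harmonic_le_of_le_compl hU hUb hH.1 (fun y hy => hH.harmonicAt hy)
    (fun y hy => (hb y hy).2) x⟩
  have := harmonic_le_of_le_compl (u := fun y => -H y) (c := 0) hU hUb hH.1.neg (fun y hy => ?_)
    (fun y hy => neg_nonpos.2 (hb y hy).1) x
  · linarith
  · have := (hH.harmonicAt hy).const_smul (c := (-1 : ℝ))
    rwa [neg_one_smul] at this

theorem IsCapPotential.decay {n : ℕ} (hn : 3 ≤ n) {D : Set (Euc n)} {x₀ : Euc n} {d : ℝ}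
    {H : Euc n → ℝ} (hd : 0 < d) (hD : D ⊆ closedBall x₀ d) (hH : IsCapPotential D H)
    {x : Euc n} (hx : d ≤ ‖x - x₀‖) : |H x| ≤ (d / ‖x - x₀‖) ^ (n - 2) := by
  have hDc : closure D ⊆ closedBall x₀ d := closure_minimal hD isClosed_closedBall
  have hlim : Tendsto (fun y => H (x₀ + y)) (cocompact (Euc n)) (𝓝 0) :=
    hH.2.2.2.2.comp (Homeomorph.addLeft x₀).isClosedEmbedding.tendsto_cocompact
  have := harmonic_exterior_decay (G := fun y => H (x₀ + y)) (by simpa using hn) hd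
    (hH.1.comp (by fun_prop)) (fun y hy => harmonicAt_translate (hH.harmonicAt fun h => ?_))
    (fun y => hH.abs_le_one (by omega) _) hlim hx
  · simpa using this
  · have := hDc h
    simp at this
    linarith

theorem IsCapPotential.decay_fderiv {n : ℕ} (hn : 3 ≤ n) {D : Set (Euc n)} {x₀ : Euc n} {d : ℝ}
    {H : Euc n → ℝ} (hd : 0 < d) (hD : D ⊆ closedBall x₀ d) (hH : IsCapPotential D H)
    {x : Euc n} {ρ : ℝ} (hρ : d ≤ ρ) (hx : ‖x - x₀‖ = ρ + d) :
    ‖fderiv ℝ H x‖ ≤ n * (2 * d / ρ) ^ (n - 2) / (ρ / 2) := by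
  have : Nontrivial (Euc n) := Module.nontrivial_of_finrank_pos (R := ℝ) (by simp; omega)
  have hDc : closure D ⊆ closedBall x₀ d := closure_minimal hD isClosed_closedBall
  have hρ0 : 0 < ρ := hd.trans_le hρ
  have hball : ∀ y ∈ closedBall x (ρ / 2), ρ / 2 + d ≤ ‖y - x₀‖ := by
    intro y hy
    have hyx : ‖x - y‖ ≤ ρ / 2 := by simpa [dist_eq_norm, norm_sub_rev] using hy
    have := norm_add_le (x - y) (y - x₀)
    rw [sub_add_sub_cancel, hx] at this
    linarith
  have := norm_fderiv_le_of_harmonic (u := H) (c := x) (s := ρ / 2) (M := (2 * d / ρ) ^ (n - 2))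
    (by positivity) (fun y hy => hH.harmonicAt fun h => ?_) fun y hy => ?_
  · simpa using this
  · have h1 := hball y hy
    have h2 := hDc h
    rw [mem_closedBall, dist_eq_norm] at h2
    linarith
  · have h1 := hball y hy
    refine (hH.decay hn hd hD (by linarith)).trans ?_
    refine pow_le_pow_left₀ (by positivity) ?_ _
    rw [div_le_div_iff₀ (by linarith) hρ0]
    nlinarith

theorem IsCapPotentialRel.decay {D : Set (Euc 2)} {x₀ : Euc 2} {d : ℝ} {H : Euc 2 → ℝ}
    (hd : 0 < d) (hd1 : d < 1) (hD : D ⊆ closedBall x₀ d) (hH : IsCapPotentialRel x₀ D H)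
    {x : Euc 2} (hx : d ≤ ‖x - x₀‖) (hx1 : ‖x - x₀‖ ≤ 1) :
    H x ≤ Real.log ‖x - x₀‖ / Real.log d := by
  have hDc : closure D ⊆ closedBall x₀ d := closure_minimal hD isClosed_closedBall
  have := harmonic_annulus_le_log (G := fun y => H (x₀ + y)) (by simp) hd hd1
    (hH.1.comp (by fun_prop))
    (fun y hy hy1 => harmonicAt_translate (hH.harmonicAt ⟨by simpa using hy1, fun h => ?_⟩))
    (fun y => (hH.mem_Icc two_pos _).2) (fun y hy => hH.2.2.2.2 _ (by simp [hy])) hx hx1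
  · simpa using this
  · have := hDc h
    simp at this
    linarith

theorem IsCapPotentialRel.norm_fderiv_le {D : Set (Euc 2)} {x₀ : Euc 2} {d : ℝ} {H : Euc 2 → ℝ}
    (hd : 0 < d) (hd1 : d < 1 / 16) (hD : D ⊆ closedBall x₀ d) (hH : IsCapPotentialRel x₀ D H)
    {x : Euc 2} (hx : 4 * d ≤ ‖x - x₀‖) (hx1 : ‖x - x₀‖ < 1) :
    ‖fderiv ℝ H x‖ ≤ 160 * (-Real.log d)⁻¹ ∨
      ‖fderiv ℝ H x‖ ≤ 8 * (128 * d / ‖x - x₀‖ + (-Real.log d)⁻¹) / ‖x - x₀‖ := by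
  have hDc : closure D ⊆ closedBall x₀ d := closure_minimal hD isClosed_closedBall
  have hc : Continuous fun y => H (x₀ + y) := hH.1.comp (by fun_prop)
  have hΔ : ∀ y, d < ‖y‖ → ‖y‖ < 1 → HarmonicAt (fun y => H (x₀ + y)) y := by
    refine fun y hy hy1 =>
      harmonicAt_translate (hH.harmonicAt ⟨by simpa using hy1, fun h => ?_⟩)
    have := hDc h
    simp at this
    linarith
  have h0 : ∀ y, ‖y‖ = 1 → H (x₀ + y) = 0 := fun y hy => hH.2.2.2.2 _ (by simp [hy])
  have hfd : fderiv ℝ (fun y => H (x₀ + y)) (x - x₀) = fderiv ℝ H x := by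
    rw [fderiv_comp_add_left, add_sub_cancel]
  rw [← hfd]
  rcases le_total (1 / 4) ‖x - x₀‖ with h | h
  · exact .inl (harmonic_annulus_gradient_outer (by simp) hd hd1 hc hΔ
      (fun y => (hH.mem_Icc two_pos _).1) (fun y => (hH.mem_Icc two_pos _).2) h0 h hx1)
  · exact .inr (harmonic_annulus_gradient_inner (by simp) hd hc hΔ
      (fun y => (hH.mem_Icc two_pos _).1) (fun y => (hH.mem_Icc two_pos _).2) h0 hx h)

theorem four_le_of_exp_neg_sqrt_le {L ρ : ℝ}
    (h : Real.exp (-(Real.exp (-4) / 2 * √L)) ≤ ρ) (hρ : ρ < 1 - Real.exp (-L)) : 4 ≤ L := by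
  by_contra! hlt
  have h1 := Real.add_one_le_exp (-(Real.exp (-4) / 2 * √L))
  have h2 : √L ≤ 2 := by
    rw [Real.sqrt_le_left (by norm_num)]; linarith
  have h3 : Real.exp (-4) < Real.exp (-L) := Real.exp_lt_exp.2 (by linarith)
  nlinarith [Real.exp_pos (-4)]

theorem exp_neg_le_of_exp_neg_sqrt_le {L ρ : ℝ} (hL : 4 ≤ L)
    (h : Real.exp (-(Real.exp (-4) / 2 * √L)) ≤ ρ) :
    4 * Real.exp (-L) ≤ ρ ∧ Real.exp (-L) ≤ 4 * L⁻¹ * ρ := by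
  have hsqrt : √L ≤ L := by
    rw [Real.sqrt_le_left (by linarith)]; nlinarith
  have he : Real.exp (-4) / 2 ≤ 1 / 4 := by
    have := Real.add_one_le_exp (4 : ℝ)
    rw [Real.exp_neg, div_le_iff₀ two_pos, inv_le_comm₀ (Real.exp_pos _) (by norm_num)]
    linarith
  have h1 : Real.exp (-(L / 4)) ≤ ρ := by
    refine le_trans (Real.exp_le_exp.2 ?_) h
    nlinarith [Real.sqrt_nonneg L]
  have h2 : Real.exp (-L) = Real.exp (-(3 * L / 4)) * Real.exp (-(L / 4)) := by
    rw [← Real.exp_add]; ring_nf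
  have h3 := Real.add_one_le_exp (3 * L / 4)
  have h4 : Real.exp (-(3 * L / 4)) ≤ (3 * L / 4 + 1)⁻¹ := by
    rw [Real.exp_neg]; gcongr
  have h5 : Real.exp (-L) ≤ (3 * L / 4 + 1)⁻¹ * ρ := by
    rw [h2]; gcongr
  have hρ : 0 < ρ := (Real.exp_pos _).trans_le h1
  constructor
  · have : (3 * L / 4 + 1)⁻¹ ≤ 1 / 4 := by
      rw [inv_le_comm₀ (by linarith) (by norm_num)]; linarith
    nlinarith
  · refine h5.trans ?_
    gcongr
    rw [← div_eq_mul_inv, inv_le_comm₀ (by linarith) (by positivity), inv_div]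
    linarith

end CapacityPotential

/-- **Lemma 2.1** (pointwise decay of the capacity potential away from `B(D)`):
with `ρ(x) = dist(x, B(D))` and `d` the radius of `B(D)`, for `n ≥ 3` and `ρ(x) ≥ C₀ d`,
`|H(x)| ≤ C d^{n-2}/ρ(x)^{n-2}` and `|∇H(x)| ≤ C d^{n-2}/ρ(x)^{n-1}`;
for `n = 2` and `ρ(x) ≥ exp(-C₀ √|ln d|)`,
`|H(x)| ≤ C |ln d|⁻¹ |ln ρ(x)|` and `|∇H(x)| ≤ C |ln d|⁻¹ / ρ(x)`. -/
theorem capacity_potential_decay :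
    (∀ n : ℕ, 3 ≤ n → ∃ C > 0, ∃ C₀ > 0,
      ∀ (D : Set (Euc n)) (x₀ : Euc n) (d : ℝ) (H : Euc n → ℝ),
        LipschitzDomain D → 0 < d → D ⊆ closedBall x₀ d →
        (∀ (y : Euc n) (ρ : ℝ), D ⊆ closedBall y ρ → d ≤ ρ) →
        IsCapPotential D H →
        ∀ x : Euc n, x ∉ closedBall x₀ d → C₀ * d ≤ infDist x (closedBall x₀ d) →
          |H x| ≤ C * d ^ (n - 2) / (infDist x (closedBall x₀ d)) ^ (n - 2) ∧
          ‖fderiv ℝ H x‖ ≤ C * d ^ (n - 2) / (infDist x (closedBall x₀ d)) ^ (n - 1)) ∧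
    (∃ C > 0, ∃ C₀ > 0,
      ∀ (D : Set (Euc 2)) (x₀ : Euc 2) (d : ℝ) (H : Euc 2 → ℝ),
        LipschitzDomain D → 0 < d → d < 1 → D ⊆ closedBall x₀ d →
        (∀ (y : Euc 2) (ρ : ℝ), D ⊆ closedBall y ρ → d ≤ ρ) →
        IsCapPotentialRel x₀ D H →
        ∀ x : Euc 2, x ∉ closedBall x₀ d →
          Real.exp (-(C₀ * Real.sqrt |Real.log d|)) ≤ infDist x (closedBall x₀ d) →
          |H x| ≤ C * |Real.log d|⁻¹ * |Real.log (infDist x (closedBall x₀ d))| ∧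
          ‖fderiv ℝ H x‖ ≤ C * |Real.log d|⁻¹ / infDist x (closedBall x₀ d)) := by
  refine ⟨fun n hn => ⟨n * 2 ^ (n - 1), by positivity, 1, one_pos, ?_⟩,
    5000, by norm_num, Real.exp (-4) / 2, by positivity, ?_⟩
  · intro D x₀ d H _ hd hD _ hH x hx hρ
    have hr := infDist_closedBall_eq hd.le hx
    set ρ := infDist x (closedBall x₀ d)
    rw [one_mul] at hρ
    have hρ0 : 0 < ρ := hd.trans_le hρ
    have hn1 : n - 1 = n - 2 + 1 := by omega
    have hn0 : (1 : ℝ) ≤ n := by exact_mod_cast (by omega : 1 ≤ n)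
    constructor
    · calc |H x| ≤ (d / ‖x - x₀‖) ^ (n - 2) := hH.decay hn hd hD (by linarith)
        _ ≤ 1 * (d / ρ) ^ (n - 2) := by rw [one_mul]; gcongr; linarith
        _ ≤ n * 2 ^ (n - 1) * (d / ρ) ^ (n - 2) := by
          gcongr
          exact one_le_mul_of_one_le_of_one_le hn0 (one_le_pow₀ one_le_two)
        _ = n * 2 ^ (n - 1) * d ^ (n - 2) / ρ ^ (n - 2) := by rw [div_pow]; ring
    · refine (hH.decay_fderiv hn hd hD hρ (by linarith)).trans (le_of_eq ?_)
      rw [div_pow, mul_pow, hn1, pow_succ, pow_succ]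
      field_simp
  · intro D x₀ d H _ hd hd1 hD _ hH x hx hρ
    have hr := infDist_closedBall_eq hd.le hx
    have hxd : d < ‖x - x₀‖ := by simpa [dist_eq_norm] using hx
    set ρ := infDist x (closedBall x₀ d)
    have hlog : Real.log d < 0 := Real.log_neg hd hd1
    have hρ0 : 0 < ρ := by linarith
    rw [abs_of_neg hlog] at hρ ⊢
    set L := -Real.log d with hL
    have hL0 : 0 < L := neg_pos.2 hlog
    have hdL : d = Real.exp (-L) := by rw [hL, neg_neg, Real.exp_log hd]
    rcases le_or_gt 1 ‖x - x₀‖ with h1 | h1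
    · have hHx : H x = 0 := hH.2.2.2.2 x (by simpa [dist_eq_norm] using h1)
      have hmin : IsLocalMin H x :=
        Eventually.of_forall fun y => by rw [hHx]; exact (hH.mem_Icc two_pos y).1
      rw [hHx, hmin.fderiv_eq_zero, abs_zero, norm_zero]
      exact ⟨by positivity, by positivity⟩
    have hL4 : 4 ≤ L := four_le_of_exp_neg_sqrt_le hρ (by linarith)
    obtain ⟨hd4, hdρ⟩ := exp_neg_le_of_exp_neg_sqrt_le hL4 hρ
    rw [← hdL] at hd4 hdρ
    constructor
    · rw [abs_of_nonneg (hH.mem_Icc two_pos x).1]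
      calc H x ≤ Real.log ‖x - x₀‖ / Real.log d := hH.decay hd hd1 hD hxd.le h1.le
        _ = 1 * L⁻¹ * -Real.log ‖x - x₀‖ := by rw [hL, inv_neg]; ring
        _ ≤ 5000 * L⁻¹ * |Real.log ρ| := by
          have hlogr : Real.log ‖x - x₀‖ ≤ 0 := Real.log_nonpos (norm_nonneg _) h1.le
          have hlogρ : Real.log ρ ≤ Real.log ‖x - x₀‖ := Real.log_le_log hρ0 (by linarith)
          rw [abs_of_nonpos (hlogρ.trans hlogr)]
          gcongr
          · linarith
          · norm_num
    · have hd16 : d < 1 / 16 := by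
        have h2 := Real.add_one_lt_exp (one_ne_zero (α := ℝ))
        rw [one_add_one_eq_two] at h2
        calc d ≤ Real.exp (-4) := by rw [hdL]; exact Real.exp_le_exp.2 (by linarith)
          _ = (Real.exp 1 ^ 4)⁻¹ := by rw [← Real.exp_nat_mul, ← Real.exp_neg]; norm_num
          _ < ((2 : ℝ) ^ 4)⁻¹ := by gcongr
          _ = 1 / 16 := by norm_num
      rcases hH.norm_fderiv_le hd hd16 hD (by linarith) h1 with h | h
      · refine h.trans ?_
        rw [le_div_iff₀ hρ0]
        have : 0 < L⁻¹ := by positivity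
        nlinarith
      · refine h.trans ?_
        have h128 : 128 * d / ‖x - x₀‖ ≤ 512 * L⁻¹ := by
          rw [div_le_iff₀ (by linarith)]
          have : 4 * L⁻¹ * ρ ≤ 4 * L⁻¹ * ‖x - x₀‖ := by gcongr; linarith
          linarith
        have hLinv : 0 < L⁻¹ := by positivity
        rw [← hL]
        exact div_le_div₀ (by positivity) (by linarith) hρ0 (by linarith)

end
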